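/- arXiv:2511.13403 — 3 statements merged into one kernel-verified Lean document; each statement's English description precedes it below -/
import Mathlib

section
/- Let $\overline x,\overline y\in\mathbb R^N$ with $\overline a=\overline x-\overline y$ and $0<|\overline a|\le\tfrac18$. Let $\beta\in(0,1)$, $t_0\in(0,1)$ with $(1+\delta_0)|\overline a|<t_0$, define $\varphi(t)=t-\tfrac14 t^{1+\beta}$ for $t\in[0,t_0]$ and $\varphi(t)=\varphi(t_0)$ for $t>t_0$, and set $\phi(x,y)=\varphi(|x-y|)$; let $\delta^2\phi(\cdot,\overline y)(\overline x,z)=\phi(\overline x,\overline y)-\phi(\overline x+z,\overline y)+D_x\phi(\overline x,\overline y)\cdot z$. Let $\mathcal D=\{z\in B_{\delta_0|\overline a|}:|\langle\overline a,z\rangle|\ge(1-\eta_0)|\overline a||z|\}$ with $\delta_0,\eta_0\in(0,\tfrac12)$. Then there exists an absolute constant $\varepsilon\in(0,\tfrac12)$ such that, whenever $\eta_0,\delta_0\le\min\{\varepsilon,\delta_1|\overline a|^\beta\}$ with $\delta_1=\tfrac{\beta(1+\beta)}{384}$, one has $\tfrac{\beta(1+\beta)}{64}|\overline a|^{\beta-1}|z|^2\le\delta^2\phi(\cdot,\overline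 y)(\overline x,z)\le\tfrac{\beta(1+\beta)}{4}|\overline a|^{\beta-1}|z|^2$ for every $z\in\mathcal D$. -/
open Metric Set RealInnerProductSpace

noncomputable section

theorem aux_tangent (f f' f'' : ℝ → ℝ)
    (h1 : ∀ x ∈ Icc (1/2 : ℝ) (3/2), HasDerivAt f (f' x) x)
    (h2 : ∀ x ∈ Icc (1/2 : ℝ) (3/2), HasDerivAt f' (f'' x) x)
    (h3 : ∀ x ∈ Icc (1/2 : ℝ) (3/2), 0 ≤ f'' x) (r : ℝ) (hr : r ∈ Icc (1/2 : ℝ) (3/2)) :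
    f 1 + f' 1 * (r - 1) ≤ f r := by
  have hc : ConvexOn ℝ (Icc (1/2 : ℝ) (3/2)) f := by
    apply convexOn_of_hasDerivWithinAt2_nonneg (f' := f') (f'' := f'') (convex_Icc _ _)
    · exact fun x hx => (h1 x hx).continuousAt.continuousWithinAt
    · exact fun x hx => (h1 x (interior_subset hx)).hasDerivWithinAt
    · exact fun x hx => (h2 x (interior_subset hx)).hasDerivWithinAt
    · exact fun x hx => h3 x (interior_subset hx)
  have h1m : (1 : ℝ) ∈ Icc (1/2 : ℝ) (3/2) := by constructor <;> norm_num
  rcases lt_trichotomy r 1 with h | h | h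
  · have := hc.slope_le_of_hasDerivAt hr h1m h (h1 1 h1m)
    rw [slope_def_field, div_le_iff₀ (by linarith)] at this
    linarith
  · subst h; simp
  · have := hc.le_slope_of_hasDerivAt h1m hr h (h1 1 h1m)
    rw [slope_def_field, le_div_iff₀ (by linarith)] at this
    linarith

theorem aux_pow (β r : ℝ) (h0 : 0 < β) (hβ : β < 1) (hr : r ∈ Icc (1/2 : ℝ) (3/2)) :
    β * (1 + β) / 3 * (r - 1) ^ 2 ≤ r ^ (1 + β) - 1 - (1 + β) * (r - 1) ∧
    r ^ (1 + β) - 1 - (1 + β) * (r - 1) ≤ β * (1 + β) * (r - 1) ^ 2 := by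
  have d1 : ∀ x ∈ Icc (1/2 : ℝ) (3/2),
      HasDerivAt (fun x : ℝ => x ^ (1 + β)) ((1 + β) * x ^ β) x := by
    intro x hx
    have hx0 : x ≠ 0 := by have := hx.1; intro h; subst h; norm_num at this
    simpa using Real.hasDerivAt_rpow_const (x := x) (p := 1 + β) (Or.inl hx0)
  have d2 : ∀ x ∈ Icc (1/2 : ℝ) (3/2),
      HasDerivAt (fun x : ℝ => (1 + β) * x ^ β) ((1 + β) * (β * x ^ (β - 1))) x := by
    intro x hx
    have hx0 : x ≠ 0 := by have := hx.1; intro h; subst h; norm_num at this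
    exact (Real.hasDerivAt_rpow_const (x := x) (p := β) (Or.inl hx0)).const_mul _
  have q1 : ∀ (c : ℝ), ∀ x ∈ Icc (1/2 : ℝ) (3/2),
      HasDerivAt (fun x : ℝ => c * (x - 1) ^ 2) (2 * c * (x - 1)) x := by
    intro c x _
    have := (((hasDerivAt_id x).sub_const 1).pow 2).const_mul c
    exact this.congr_deriv (by simp; ring)
  have q2 : ∀ (c : ℝ), ∀ x ∈ Icc (1/2 : ℝ) (3/2),
      HasDerivAt (fun x : ℝ => 2 * c * (x - 1)) (2 * c) x := by
    intro c x _
    have := ((hasDerivAt_id x).sub_const 1).const_mul (2 * c)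
    exact this.congr_deriv (by simp)
  have b1 : ∀ x ∈ Icc (1/2 : ℝ) (3/2), 2 / 3 ≤ x ^ (β - 1) := by
    intro x hx
    have hx0 : 0 < x := by linarith [hx.1]
    calc (2/3 : ℝ) = (3/2 : ℝ) ^ (-1 : ℝ) := by rw [Real.rpow_neg_one]; norm_num
      _ ≤ (3/2 : ℝ) ^ (β - 1) := Real.rpow_le_rpow_of_exponent_le (by norm_num) (by linarith)
      _ ≤ x ^ (β - 1) := Real.rpow_le_rpow_of_nonpos hx0 hx.2 (by linarith)
  have b2 : ∀ x ∈ Icc (1/2 : ℝ) (3/2), x ^ (β - 1) ≤ 2 := by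
    intro x hx
    calc x ^ (β - 1) ≤ (1/2 : ℝ) ^ (β - 1) :=
          Real.rpow_le_rpow_of_nonpos (by norm_num) hx.1 (by linarith)
      _ ≤ (1/2 : ℝ) ^ (-1 : ℝ) :=
          Real.rpow_le_rpow_of_exponent_ge (by norm_num) (by norm_num) (by linarith)
      _ = 2 := by rw [Real.rpow_neg_one]; norm_num
  have hp : 0 < (1 + β) * β := by positivity
  constructor
  · have := aux_tangent _ _ _ (fun x hx => (d1 x hx).sub (q1 (β * (1 + β) / 3) x hx))
      (fun x hx => (d2 x hx).sub (q2 (β * (1 + β) / 3) x hx))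
      (fun x hx => by nlinarith [b1 x hx]) r hr
    simp at this
    linarith
  · have := aux_tangent _ _ _ (fun x hx => (q1 (β * (1 + β)) x hx).sub (d1 x hx))
      (fun x hx => (q2 (β * (1 + β)) x hx).sub (d2 x hx))
      (fun x hx => by nlinarith [b2 x hx]) r hr
    simp at this
    linarith

set_option maxHeartbeats 1000000 in
theorem aux_core (a β δ η ζ u s : ℝ) (ha : 0 < a) (ha8 : a ≤ 1/8) (h0 : 0 < β) (hβ : β < 1)
    (hδ : δ ≤ 1/16) (hη0 : 0 < η) (hη : η ≤ 1/16) (hη' : η ≤ β * (1 + β) / 384 * a ^ β)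
    (hζ0 : 0 ≤ ζ) (hζ : ζ < δ * a) (hs0 : 0 ≤ s) (hs : s ^ 2 = a ^ 2 + 2 * (a * u) + ζ ^ 2)
    (hu1 : |u| ≤ ζ) (hu2 : (1 - η) * ζ ≤ |u|) :
    β * (1 + β) / 64 * a ^ (β - 1) * ζ ^ 2 ≤
      (a - a ^ (1 + β) / 4) - (s - s ^ (1 + β) / 4) + (1 - (1 + β) / 4 * a ^ β) * u ∧
    (a - a ^ (1 + β) / 4) - (s - s ^ (1 + β) / 4) + (1 - (1 + β) / 4 * a ^ β) * u ≤
      β * (1 + β) / 4 * a ^ (β - 1) * ζ ^ 2 := by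
  have hP0 : 0 < a ^ β := Real.rpow_pos_of_pos ha _
  have hP1 : a ^ β ≤ 1 := Real.rpow_le_one ha.le (by linarith) h0.le
  have e1 : a ^ (1 + β) = a * a ^ β := by rw [Real.rpow_add ha, Real.rpow_one]
  have e2 : a ^ (β - 1) = a ^ β / a := by rw [Real.rpow_sub ha, Real.rpow_one]
  obtain ⟨hul, huu⟩ := abs_le.1 hu1
  have hζa : ζ ≤ a / 16 := by nlinarith
  have hsl : a - ζ ≤ s := by
    apply (abs_le_of_sq_le_sq' _ hs0).2
    nlinarith [mul_le_mul_of_nonneg_left hul ha.le]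
  have hsu : s ≤ a + ζ := by
    apply (abs_le_of_sq_le_sq' _ (by linarith)).2
    nlinarith [mul_le_mul_of_nonneg_left huu ha.le]
  obtain ⟨r, rfl⟩ : ∃ r, s = a * r := ⟨s / a, by field_simp⟩
  have hr : r ∈ Icc (1/2 : ℝ) (3/2) := by
    constructor <;> by_contra! h <;> nlinarith
  have hr0 : 0 ≤ r := by linarith [hr.1]
  obtain ⟨t1, t2⟩ := aux_pow β r h0 hβ hr
  have e3 : (a * r) ^ (1 + β) = a * a ^ β * r ^ (1 + β) := by
    rw [Real.mul_rpow ha.le hr0, e1]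
  rw [e1, e2, e3]
  generalize r ^ (1 + β) = R at *
  generalize a ^ β = P at *
  set T := R - 1 - (1 + β) * (r - 1) with hT
  set e := a * r - a - u with he
  have hQ : (a - a * P / 4) - (a * r - a * P * R / 4) + (1 - (1 + β) / 4 * P) * u
      = -(1 - (1 + β) / 4 * P) * e + a * P * T / 4 := by
    rw [hT, he]; ring
  rw [hQ]
  have hee : e * (a * r + a + u) = ζ ^ 2 - u ^ 2 := by rw [he]; linear_combination hs
  have hu3 : u ^ 2 ≤ ζ ^ 2 := sq_le_sq' hul huu
  have hu4 : (1 - 2 * η) * ζ ^ 2 ≤ u ^ 2 := by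
    have : ((1 - η) * ζ) ^ 2 ≤ |u| ^ 2 := by
      apply pow_le_pow_left₀ _ hu2
      apply mul_nonneg <;> linarith
    rw [sq_abs] at this
    nlinarith [mul_nonneg (sq_nonneg η) (sq_nonneg ζ)]
  have hD : a ≤ a * r + a + u := by linarith
  have he0 : 0 ≤ e := by
    have hDp : 0 < a * r + a + u := by linarith
    by_contra! h
    have := mul_neg_of_neg_of_pos h hDp
    linarith
  have he1 : e * a ≤ 2 * η * ζ ^ 2 := by
    have := mul_le_mul_of_nonneg_left hD he0
    linarith
  have hbP : 0 ≤ (1 + β) * P := by positivity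
  have hbP2 : (1 + β) * P ≤ 2 * 1 := mul_le_mul (by linarith) hP1 hP0.le (by norm_num)
  have hp0 : 0 ≤ 1 - (1 + β) / 4 * P := by linarith
  have hp1 : 1 - (1 + β) / 4 * P ≤ 1 := by linarith
  have hb : 0 < β * (1 + β) := by positivity
  -- bounds on the radial increment
  have hw : (a * (r - 1)) ^ 2 ≤ ζ ^ 2 := by
    apply sq_le_sq' <;> linarith
  have hw2 : 3 / 4 * ζ ^ 2 ≤ (a * (r - 1)) ^ 2 := by
    have he2 : e ≤ η * ζ := by
      have : e * a ≤ η * ζ * a := by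
        have h1 : 0 ≤ η * ζ := by positivity
        have h2 := mul_le_mul_of_nonneg_left hζa h1
        have h3 : 0 ≤ η * ζ * a := by positivity
        linarith
      exact le_of_mul_le_mul_right this ha
    have h4 := mul_le_mul_of_nonneg_right hη hζ0
    have he3 : e ≤ ζ / 16 := by linarith
    have hu5 : 15 / 16 * ζ ≤ |u| := by linarith
    have : 14 / 16 * ζ ≤ |a * (r - 1)| := by
      have hae : a * (r - 1) = u + e := by rw [he]; ring
      rw [hae]
      have h := abs_sub_abs_le_abs_sub u (-e)
      rw [abs_neg, abs_of_nonneg he0, sub_neg_eq_add] at h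
      linarith
    have := pow_le_pow_left₀ (by positivity) this 2
    rw [sq_abs] at this
    linarith [sq_nonneg ζ]
  constructor
  · have : β * (1 + β) / 64 * (P / a) * ζ ^ 2 = (β * (1 + β) / 64 * P * ζ ^ 2) / a := by ring
    rw [this, div_le_iff₀ ha]
    have k1 : (1 - (1 + β) / 4 * P) * (e * a) ≤ e * a :=
      mul_le_of_le_one_left (by positivity) hp1
    have k2 : 2 * η * ζ ^ 2 ≤ 2 * (β * (1 + β) / 384 * P) * ζ ^ 2 := by gcongr
    have k3 : P / 4 * (β * (1 + β) / 3 * (a * (r - 1)) ^ 2) ≤ P / 4 * (a ^ 2 * T) := by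
      apply mul_le_mul_of_nonneg_left _ (by positivity)
      linarith [mul_le_mul_of_nonneg_left t1 (sq_nonneg a)]
    have k4 : P / 4 * (β * (1 + β) / 3 * (3 / 4 * ζ ^ 2))
        ≤ P / 4 * (β * (1 + β) / 3 * (a * (r - 1)) ^ 2) := by gcongr
    have k5 : 0 ≤ β * (1 + β) * P * ζ ^ 2 := by positivity
    linarith
  · have : β * (1 + β) / 4 * (P / a) * ζ ^ 2 = (β * (1 + β) / 4 * P * ζ ^ 2) / a := by ring
    rw [this, le_div_iff₀ ha]
    have k1 : 0 ≤ (1 - (1 + β) / 4 * P) * (e * a) := by positivity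
    have k3 : P / 4 * (a ^ 2 * T) ≤ P / 4 * (β * (1 + β) * (a * (r - 1)) ^ 2) := by
      apply mul_le_mul_of_nonneg_left _ (by positivity)
      linarith [mul_le_mul_of_nonneg_left t2 (sq_nonneg a)]
    have k4 : P / 4 * (β * (1 + β) * (a * (r - 1)) ^ 2)
        ≤ P / 4 * (β * (1 + β) * ζ ^ 2) := by gcongr
    linarith

theorem aux_grad {N : ℕ} (xb yb z : EuclideanSpace ℝ (Fin N)) (β t₀ : ℝ)
    (hne : xb - yb ≠ 0) (ht : ‖xb - yb‖ < t₀) :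
    ⟪gradient (fun w : EuclideanSpace ℝ (Fin N) =>
                    (if ‖w - yb‖ ≤ t₀ then ‖w - yb‖ - ‖w - yb‖ ^ (1 + β) / 4
                      else t₀ - t₀ ^ (1 + β) / 4)) xb, z⟫ =
    (1 - (1 + β) / 4 * ‖xb - yb‖ ^ β) * (⟪xb - yb, z⟫ / ‖xb - yb‖) := by
  have ha : 0 < ‖xb - yb‖ := norm_pos_iff.2 hne
  have hev : (fun w : EuclideanSpace ℝ (Fin N) =>
      (if ‖w - yb‖ ≤ t₀ then ‖w - yb‖ - ‖w - yb‖ ^ (1 + β) / 4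
        else t₀ - t₀ ^ (1 + β) / 4)) =ᶠ[nhds xb]
      (fun w => ‖w - yb‖ - ‖w - yb‖ ^ (1 + β) / 4) := by
    have hc : ContinuousAt (fun w : EuclideanSpace ℝ (Fin N) => ‖w - yb‖) xb := by fun_prop
    filter_upwards [hc.eventually_lt_const ht] with w hw
    simp [le_of_lt hw]
  have hn : HasFDerivAt (fun w : EuclideanSpace ℝ (Fin N) => ‖w - yb‖)
      ((1 / (2 * Real.sqrt (‖xb - yb‖ ^ 2))) • (2 • (innerSL ℝ (xb - yb)).comp
        (ContinuousLinearMap.id ℝ (EuclideanSpace ℝ (Fin N))))) xb := by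
    have h := (((hasFDerivAt_id xb).sub_const yb).norm_sq).sqrt (by simpa using hne)
    refine h.congr_of_eventuallyEq (Filter.Eventually.of_forall fun w => ?_)
    simp
  have hg : HasDerivAt (fun t : ℝ => t - t ^ (1 + β) / 4)
      (1 - (1 + β) / 4 * ‖xb - yb‖ ^ β) ‖xb - yb‖ := by
    have h := (hasDerivAt_id ‖xb - yb‖).sub
      ((Real.hasDerivAt_rpow_const (x := ‖xb - yb‖) (p := 1 + β) (Or.inl ha.ne')).div_const 4)
    exact h.congr_deriv (by simp; ring)
  have hf := (hg.comp_hasFDerivAt xb hn).congr_of_eventuallyEq hev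
  rw [gradient, InnerProductSpace.toDual_symm_apply, hf.fderiv]
  simp [Real.sqrt_sq ha.le]
  left
  field_simp
  rw [inner_sub_left]

/-- Lemma 2.1(1): second-order difference bounds for the truncated
concave function `φ(t) = t - t^{1+β}/4` along the cone `𝒟`. -/
theorem statement4 :
    ∃ ε ∈ Ioo (0 : ℝ) (1/2),
      ∀ (N : ℕ), 0 < N →
      ∀ (xb yb : EuclideanSpace ℝ (Fin N)) (β t₀ δ₀ η₀ : ℝ),
        xb - yb ≠ 0 → ‖xb - yb‖ ≤ 1/8 →
        β ∈ Ioo (0 : ℝ) 1 → t₀ ∈ Ioo (0 : ℝ) 1 →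
        δ₀ ∈ Ioo (0 : ℝ) (1/2) → η₀ ∈ Ioo (0 : ℝ) (1/2) →
        (1 + δ₀) * ‖xb - yb‖ < t₀ →
        η₀ ≤ min ε (β * (1 + β) / 384 * ‖xb - yb‖ ^ β) →
        δ₀ ≤ min ε (β * (1 + β) / 384 * ‖xb - yb‖ ^ β) →
        ∀ z : EuclideanSpace ℝ (Fin N),
          z ∈ ball (0 : EuclideanSpace ℝ (Fin N)) (δ₀ * ‖xb - yb‖) →
          (1 - η₀) * ‖xb - yb‖ * ‖z‖ ≤ |(⟪xb - yb, z⟫)| →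
          β * (1 + β) / 64 * ‖xb - yb‖ ^ (β - 1) * ‖z‖ ^ 2 ≤
              (fun w : EuclideanSpace ℝ (Fin N) =>
                  (if ‖w - yb‖ ≤ t₀ then ‖w - yb‖ - ‖w - yb‖ ^ (1 + β) / 4
                    else t₀ - t₀ ^ (1 + β) / 4)) xb
                - (fun w : EuclideanSpace ℝ (Fin N) =>
                    (if ‖w - yb‖ ≤ t₀ then ‖w - yb‖ - ‖w - yb‖ ^ (1 + β) / 4
                      else t₀ - t₀ ^ (1 + β) / 4)) (xb + z)
                + ⟪gradient (fun w : EuclideanSpace ℝ (Fin N) =>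
                    (if ‖w - yb‖ ≤ t₀ then ‖w - yb‖ - ‖w - yb‖ ^ (1 + β) / 4
                      else t₀ - t₀ ^ (1 + β) / 4)) xb, z⟫ ∧
            (fun w : EuclideanSpace ℝ (Fin N) =>
                  (if ‖w - yb‖ ≤ t₀ then ‖w - yb‖ - ‖w - yb‖ ^ (1 + β) / 4
                    else t₀ - t₀ ^ (1 + β) / 4)) xb
                - (fun w : EuclideanSpace ℝ (Fin N) =>
                    (if ‖w - yb‖ ≤ t₀ then ‖w - yb‖ - ‖w - yb‖ ^ (1 + β) / 4
                      else t₀ - t₀ ^ (1 + β) / 4)) (xb + z)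
                + ⟪gradient (fun w : EuclideanSpace ℝ (Fin N) =>
                    (if ‖w - yb‖ ≤ t₀ then ‖w - yb‖ - ‖w - yb‖ ^ (1 + β) / 4
                      else t₀ - t₀ ^ (1 + β) / 4)) xb, z⟫ ≤
              β * (1 + β) / 4 * ‖xb - yb‖ ^ (β - 1) * ‖z‖ ^ 2 := by
  refine ⟨1/16, by constructor <;> norm_num, ?_⟩
  intro N _ xb yb β t₀ δ₀ η₀ hne h8 hβ ht₀ hδ hη ht hη' hδ' z hz hzi
  have ha : 0 < ‖xb - yb‖ := norm_pos_iff.2 hne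
  have hz' : ‖z‖ < δ₀ * ‖xb - yb‖ := by simpa using hz
  have hat : ‖xb - yb‖ < t₀ := by nlinarith [hδ.1]
  have hsum : xb + z - yb = (xb - yb) + z := by abel
  have hst : ‖xb + z - yb‖ ≤ t₀ := by
    rw [hsum]
    have := norm_add_le (xb - yb) z
    linarith
  rw [aux_grad xb yb z β t₀ hne hat]
  simp only [if_pos hat.le, if_pos hst]
  apply aux_core ‖xb - yb‖ β δ₀ η₀ ‖z‖ _ _ ha h8 hβ.1 hβ.2
    (hδ'.trans (min_le_left _ _)) hη.1 (hη'.trans (min_le_left _ _))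
    (hη'.trans (min_le_right _ _)) (norm_nonneg _) hz' (norm_nonneg _)
  · rw [hsum, norm_add_sq_real, mul_div_cancel₀ _ ha.ne']
  · rw [abs_div, abs_norm, div_le_iff₀ ha, mul_comm]
    exact abs_real_inner_le_norm _ _
  · rw [abs_div, abs_norm, le_div_iff₀ ha]
    linarith

end
end

section
/- Let $\overline x,\overline y\in\mathbb R^N$ with $\overline a=\overline x-\overline y$ and $0<|\overline a|\le\tfrac18$. Let $\gamma\in(0,1)$, define $\varphi(t)=t^\gamma$ and $\phi(x,y)=\varphi(|x-y|)$, and set $\delta^2\phi(\cdot,\overline y)(\overline x,z)=\phi(\overline x,\overline y)-\phi(\overline x+z,\overline y)+D_x\phi(\overline x,\overline y)\cdot z$. Let $\mathcal D=\{z\in B_{\delta_0|\overline a|}:|\langle\overline a,z\rangle|\ge(1-\eta_0)|\overline a||z|\}$ with $\delta_0,\eta_0\in(0,\tfrac12)$. Then there exists $\varepsilon\in(0,\tfrac12)$, depending only on $\gamma$, such that for all $\eta_0,\delta_0\in(0,\varepsilon]$ one has $\tfrac{\gamma(1-\gamma)2^\gamma}{32}|\overline a|^{\gamma-2}|z|^2\le\delta^2\phi(\cdot,\overline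 y)(\overline x,z)\le\gamma(1-\gamma)|\overline a|^{\gamma-2}|z|^2$ for every $z\in\mathcal D$. -/
open Metric Set RealInnerProductSpace

noncomputable section

lemma taylor_aux (p : ℝ) : ∃ C > 0, ∃ ρ > 0, ∀ u : ℝ, |u| < ρ →
    |(1 + u) ^ p - (1 + p * u + p * (p - 1) / 2 * u ^ 2)| ≤ C * |u| ^ 3 := by
  have h := (Real.one_add_rpow_hasFPowerSeriesAt_zero (a := p)).isBigO_sub_partialSum_pow 3
  obtain ⟨C, hC, h⟩ := h.exists_pos
  rw [Asymptotics.isBigOWith_iff, Metric.eventually_nhds_iff] at h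
  obtain ⟨ρ, hρ, h⟩ := h
  refine ⟨C, hC, ρ, hρ, fun u hu => ?_⟩
  have := @h u (by simpa using hu)
  simp [FormalMultilinearSeries.partialSum, Finset.sum_range_succ, -FormalMultilinearSeries.apply_eq_prod_smul_coeff, -FormalMultilinearSeries.apply_eq_pow_smul_coeff, binomialSeries_apply, Ring.choose_eq_smul, descPochhammer_succ_right, Polynomial.smeval_mul, Polynomial.smeval_natCast] at this
  convert this using 3
  ring

set_option maxHeartbeats 1000000 in
lemma core (γ : ℝ) (h0 : 0 < γ) (h1 : γ < 1) : ∃ ε ∈ Ioo (0:ℝ) (1/2), ∀ t s η : ℝ,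
    0 ≤ s → s ≤ ε → 0 ≤ η → η ≤ ε → |t| ≤ s → (1 - η) * s ≤ |t| →
    γ * (1 - γ) / 16 * s ^ 2 ≤ 1 - (1 + (2 * t + s ^ 2)) ^ (γ / 2) + γ * t ∧
    1 - (1 + (2 * t + s ^ 2)) ^ (γ / 2) + γ * t ≤ γ * (1 - γ) * s ^ 2 := by
  obtain ⟨C, hC, ρ, hρ, h⟩ := taylor_aux (γ / 2)
  set K : ℝ := 27 * C / (γ / 2) + 3 + 4 with hK
  have hK0 : 7 < K := by rw [hK]; have : 0 < 27 * C / (γ / 2) := by positivity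
                         linarith
  refine ⟨min ((1 - γ) / (2 * K)) (ρ / 4), ⟨lt_min (div_pos (by linarith) (by linarith)) (by linarith), ?_⟩, ?_⟩
  · apply lt_of_le_of_lt (min_le_left _ _)
    rw [div_lt_div_iff₀ (by linarith) (by norm_num)]
    linarith
  intro t s η hs hsε hη hηε hts hts'
  have hsρ := hsε.trans (min_le_right _ _)
  have hsK := hsε.trans (min_le_left _ _)
  have hηK := hηε.trans (min_le_left _ _)
  rw [le_div_iff₀ (by linarith)] at hsK hηK
  have hs1 : s ≤ 1 := by nlinarith
  have hη1 : η ≤ 1 := by nlinarith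
  have hu : |2 * t + s ^ 2| ≤ 3 * s := by
    have := abs_le.1 hts
    rw [abs_le]; constructor <;> nlinarith
  have hR := h (2 * t + s ^ 2) (by linarith [abs_nonneg t])
  have hR2 : C * |2 * t + s ^ 2| ^ 3 ≤ C * (3 * s) ^ 3 := by gcongr
  have hR3 := abs_le.1 (hR.trans hR2)
  have ht2 : t ^ 2 ≤ s ^ 2 := by rw [← sq_abs t]; gcongr
  have ht3 : ((1 - η) * s) ^ 2 ≤ t ^ 2 := by
    rw [← sq_abs t]; exact pow_le_pow_left₀ (mul_nonneg (by linarith) hs) hts' 2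
  have htt := abs_le.1 hts
  generalize (1 + (2 * t + s ^ 2)) ^ (γ / 2) = X at *
  have hCK : C * (3 * s) ^ 3 = (γ / 2) * (K - 7) * s ^ 3 := by rw [hK]; field_simp; ring
  rw [hCK] at hR3
  clear_value K
  -- remainder
  obtain ⟨p, rfl⟩ : ∃ p, γ = 2 * p := ⟨γ / 2, by ring⟩
  have hp : 2 * p / 2 = p := by ring
  rw [hp] at hR3
  have hp0 : 0 < p := by linarith
  have hcr1 : 4 * t * s ^ 2 + s ^ 4 ≤ 5 * s ^ 3 := by
    have e : s ^ 4 ≤ s ^ 3 := pow_le_pow_of_le_one hs hs1 (by norm_num)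
    nlinarith [sq_nonneg s]
  have hcr2 : - (5 * s ^ 3) ≤ 4 * t * s ^ 2 + s ^ 4 := by
    have e : 0 ≤ s ^ 4 := by positivity
    have e3 : 0 ≤ s ^ 3 := by positivity
    nlinarith [sq_nonneg s]
  have hK3 : (K * s) * s ^ 2 ≤ (1 - 2 * p) / 2 * s ^ 2 := by
    gcongr; linarith
  have hK4 : (7 * η) * s ^ 2 ≤ (1 - 2 * p) / 2 * s ^ 2 := by
    gcongr; nlinarith
  have e3 : 0 ≤ s ^ 3 := by positivity
  have a7 : 0 ≤ (1 - 2 * p) * s ^ 2 := mul_nonneg (by linarith) (sq_nonneg s)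
  -- normalized bracket
  have hup : -s^2 + 2 * (1 - p) * t ^ 2 + (1 - p) / 2 * (4 * t * s ^ 2 + s ^ 4) + (K - 7) * s ^ 3
      ≤ 2 * (1 - 2 * p) * s ^ 2 := by
    have a1 : (1 - p) * t ^ 2 ≤ (1 - p) * s ^ 2 := by gcongr; linarith
    have a2 : (1 - p) * (4 * t * s ^ 2 + s ^ 4) ≤ (1 - p) * (5 * s ^ 3) := by gcongr; linarith
    have a3 := mul_nonneg hp0.le e3
    linarith
  have hlo : (1 - 2 * p) / 8 * s ^ 2 ≤
      -s^2 + 2 * (1 - p) * t ^ 2 + (1 - p) / 2 * (4 * t * s ^ 2 + s ^ 4) - (K - 7) * s ^ 3 := by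
    have a1 : (1 - p) * ((1 - η) * s) ^ 2 ≤ (1 - p) * t ^ 2 := by gcongr; linarith
    have a2 : (1 - p) * (-(5 * s ^ 3)) ≤ (1 - p) * (4 * t * s ^ 2 + s ^ 4) := by gcongr; linarith
    have a3 := mul_nonneg hp0.le e3
    have a4 : (1 - p) * ((1 - 2 * η) * s ^ 2) ≤ (1 - p) * ((1 - η) * s) ^ 2 := by
      gcongr
      · linarith
      · nlinarith [sq_nonneg (η * s)]
    have a5 : 0 ≤ p * (η * s ^ 2) := by positivity
    have a6 : 0 ≤ η * s ^ 2 := by positivity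
    have a8 : (K - 7) * s ^ 3 + 7 * s ^ 3 ≤ (1 - 2 * p) / 2 * s ^ 2 := by linarith
    linarith
  have hup' := mul_le_mul_of_nonneg_left hup hp0.le
  have hlo' := mul_le_mul_of_nonneg_left hlo hp0.le
  constructor <;> linarith [hR3.1, hR3.2]

lemma grad_aux {E : Type*} [NormedAddCommGroup E] [InnerProductSpace ℝ E] [CompleteSpace E]
    (γ : ℝ) (x y z : E) (h : x - y ≠ 0) :
    (⟪gradient (fun w : E => ‖w - y‖ ^ γ) x, z⟫ : ℝ) = γ * ‖x - y‖ ^ (γ - 2) * ⟪x - y, z⟫ := by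
  have hr : 0 < ‖x - y‖ := norm_pos_iff.2 h
  have e : (fun w : E => ‖w - y‖ ^ γ) = fun w => (‖w - y‖ ^ 2) ^ (γ / 2) := by
    funext w
    rw [← Real.rpow_natCast, ← Real.rpow_mul (norm_nonneg _)]
    congr 1; push_cast; ring
  have hd := (((hasFDerivAt_id (𝕜 := ℝ) x).sub_const y).norm_sq).rpow_const (p := γ / 2)
    (Or.inl (pow_ne_zero 2 hr.ne'))
  rw [inner_gradient_left, e]
  erw [hd.fderiv]
  have e2 : (‖x - y‖ ^ 2) ^ (γ / 2 - 1) = ‖x - y‖ ^ (γ - 2) := by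
    rw [← Real.rpow_natCast, ← Real.rpow_mul (norm_nonneg _)]
    congr 1; push_cast; ring
  simp [e2, inner_sub_left]
  ring

/-- Lemma 2.1(2): second-order difference bounds for the concave power
`φ(t) = t^γ`, `γ ∈ (0,1)`, along the cone `𝒟`. -/
theorem statement5 (γ : ℝ) (hγ : γ ∈ Ioo (0 : ℝ) 1) :
    ∃ ε ∈ Ioo (0 : ℝ) (1/2),
      ∀ (N : ℕ), 0 < N →
      ∀ (xb yb : EuclideanSpace ℝ (Fin N)) (δ₀ η₀ : ℝ),
        xb - yb ≠ 0 → ‖xb - yb‖ ≤ 1/8 →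
        δ₀ ∈ Ioo (0 : ℝ) (1/2) → η₀ ∈ Ioo (0 : ℝ) (1/2) →
        δ₀ ≤ ε → η₀ ≤ ε →
        ∀ z : EuclideanSpace ℝ (Fin N),
          z ∈ ball (0 : EuclideanSpace ℝ (Fin N)) (δ₀ * ‖xb - yb‖) →
          (1 - η₀) * ‖xb - yb‖ * ‖z‖ ≤ |(⟪xb - yb, z⟫ : ℝ)| →
          γ * (1 - γ) * 2 ^ γ / 32 * ‖xb - yb‖ ^ (γ - 2) * ‖z‖ ^ 2 ≤
              (fun w : EuclideanSpace ℝ (Fin N) => ‖w - yb‖ ^ γ) xb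
                - (fun w : EuclideanSpace ℝ (Fin N) => ‖w - yb‖ ^ γ) (xb + z)
                + ⟪gradient (fun w : EuclideanSpace ℝ (Fin N) => ‖w - yb‖ ^ γ) xb, z⟫ ∧
            (fun w : EuclideanSpace ℝ (Fin N) => ‖w - yb‖ ^ γ) xb
                - (fun w : EuclideanSpace ℝ (Fin N) => ‖w - yb‖ ^ γ) (xb + z)
                + ⟪gradient (fun w : EuclideanSpace ℝ (Fin N) => ‖w - yb‖ ^ γ) xb, z⟫ ≤
              γ * (1 - γ) * ‖xb - yb‖ ^ (γ - 2) * ‖z‖ ^ 2 := by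
  obtain ⟨h0, h1⟩ := hγ
  obtain ⟨ε, hε, H⟩ := core γ h0 h1
  refine ⟨ε, hε, ?_⟩
  intro N _ xb yb δ₀ η₀ ha _ hδ hη hδε hηε z hz hcone
  rw [grad_aux γ xb yb z ha]
  have hxz : xb + z - yb = (xb - yb) + z := by abel
  simp only [hxz]
  rw [mem_ball_zero_iff] at hz
  generalize xb - yb = a at *
  have hr : 0 < ‖a‖ := norm_pos_iff.2 ha
  have hsq := norm_add_sq_real a z
  have hCS := abs_real_inner_le_norm a z
  have hz0 := norm_nonneg z
  have hn : ‖a + z‖ ^ γ = (‖a + z‖ ^ 2) ^ (γ / 2) := by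
    rw [← Real.rpow_natCast, ← Real.rpow_mul (norm_nonneg _)]
    congr 1; push_cast; ring
  have hn' : ‖a‖ ^ γ = (‖a‖ ^ 2) ^ (γ / 2) := by
    rw [← Real.rpow_natCast, ← Real.rpow_mul (norm_nonneg _)]
    congr 1; push_cast; ring
  have hfac : ‖a + z‖ ^ 2 = ‖a‖ ^ 2 * (1 + (2 * (⟪a, z⟫ / ‖a‖ ^ 2) + (‖z‖ / ‖a‖) ^ 2)) := by
    rw [hsq]; field_simp; ring
  have hpos : 0 ≤ 1 + (2 * (⟪a, z⟫ / ‖a‖ ^ 2) + (‖z‖ / ‖a‖) ^ 2) := by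
    have h2 : 0 < ‖a‖ ^ 2 := by positivity
    have h3 := sq_nonneg ‖a + z‖
    rw [hfac] at h3
    exact nonneg_of_mul_nonneg_right h3 h2
  have habs : |⟪a, z⟫ / ‖a‖ ^ 2| = |⟪a, z⟫| / ‖a‖ ^ 2 := by
    rw [abs_div, abs_of_pos (by positivity : 0 < ‖a‖ ^ 2)]
  obtain ⟨L, U⟩ := H (⟪a, z⟫ / ‖a‖ ^ 2) (‖z‖ / ‖a‖) η₀ (by positivity)
    (by rw [div_le_iff₀ hr]; exact hz.le.trans (by gcongr)) hη.1.le hηε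
    (by rw [habs, div_le_div_iff₀ (by positivity) hr]; nlinarith)
    (by rw [habs, ← mul_div_assoc, div_le_div_iff₀ hr (by positivity)]; nlinarith)
  rw [hn, hfac, Real.mul_rpow (by positivity) hpos, ← hn']
  have hp : ‖a‖ ^ γ = ‖a‖ ^ (γ - 2) * ‖a‖ ^ 2 := by
    rw [← Real.rpow_natCast, ← Real.rpow_add hr]
    congr 1; push_cast; ring
  generalize (1 + (2 * (⟪a, z⟫ / ‖a‖ ^ 2) + (‖z‖ / ‖a‖) ^ 2)) ^ (γ / 2) = X at *
  have hM : 0 < ‖a‖ ^ (γ - 2) := Real.rpow_pos_of_pos hr _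
  rw [hp]
  generalize ‖a‖ ^ (γ - 2) = M at *
  have h2 : (2:ℝ) ^ γ ≤ 2 := by
    calc (2:ℝ) ^ γ ≤ 2 ^ (1:ℝ) := Real.rpow_le_rpow_of_exponent_le (by norm_num) h1.le
      _ = 2 := by simp
  have hmid : M * ‖a‖ ^ 2 - M * ‖a‖ ^ 2 * X + γ * M * ⟪a, z⟫
      = M * ‖a‖ ^ 2 * (1 - X + γ * (⟪a, z⟫ / ‖a‖ ^ 2)) := by
    field_simp
  rw [hmid]
  have hMr : 0 ≤ M * ‖a‖ ^ 2 := by positivity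
  have hzz : M * ‖a‖ ^ 2 * (‖z‖ / ‖a‖) ^ 2 = M * ‖z‖ ^ 2 := by field_simp
  constructor
  · refine le_trans ?_ (mul_le_mul_of_nonneg_left L hMr)
    have e1 : M * ‖a‖ ^ 2 * (γ * (1 - γ) / 16 * (‖z‖ / ‖a‖) ^ 2)
        = γ * (1 - γ) * 2 / 32 * M * ‖z‖ ^ 2 := by
      linear_combination (γ * (1 - γ) / 16) * hzz
    rw [e1]
    have : 0 ≤ γ * (1 - γ) := mul_nonneg h0.le (by linarith)
    gcongr
  · refine (mul_le_mul_of_nonneg_left U hMr).trans (le_of_eq ?_)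
    linear_combination (γ * (1 - γ)) * hzz

end
end

section
/- Let $\epsilon,\delta>0$ and let $(a_j)_{j\in\mathbb N}$ be a sequence of positive real numbers with $\sum_{j=1}^\infty a_j<\infty$. Then there exists a sequence $(c_j)_{j\in\mathbb N}$ of positive real numbers with $c_j\to0$ as $j\to\infty$, $\sup_j c_j\le\tfrac1\epsilon$, $\sum_{j=1}^\infty\frac{a_j}{c_j}<\infty$, and $\epsilon\bigl(1-\tfrac\delta2\bigr)\sum_{j=1}^\infty a_j\le\sum_{j=1}^\infty\frac{a_j}{c_j}\le\epsilon(1+\delta)\sum_{j=1}^\infty a_j$. -/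
open Filter

theorem aux_weights (a : ℕ → ℝ) (ha : ∀ j, 0 < a j) (hsum : Summable a) :
    ∃ b : ℕ → ℝ, (∀ j, 0 < b j) ∧ Tendsto b atTop atTop ∧ Summable (fun j => a j * b j) := by
  obtain ⟨r, hr⟩ : ∃ r : ℕ → ℝ, r = fun n => ∑' k, a (k + n) := ⟨_, rfl⟩
  have hs : ∀ n, Summable (fun k => a (k + n)) := fun n => (summable_nat_add_iff n).2 hsum
  have hpos : ∀ n, 0 < r n := fun n => by
    rw [hr]; exact (hs n).tsum_pos (fun k => (ha _).le) 0 (ha _)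
  have hstep : ∀ n, r n = a n + r (n + 1) := fun n => by
    simp only [hr]
    rw [(hs n).tsum_eq_zero_add]
    rw [zero_add]
    congr 1
    apply tsum_congr
    intro k
    congr 1
    omega
  have hlim : Tendsto r atTop (nhds 0) := by rw [hr]; exact tendsto_sum_nat_add a
  have hq : ∀ n, 0 < Real.sqrt (r n) := fun n => Real.sqrt_pos.2 (hpos n)
  have hqlim : Tendsto (fun n => Real.sqrt (r n)) atTop (nhds 0) := by
    simpa using hlim.sqrt
  refine ⟨fun n => (Real.sqrt (r n))⁻¹, fun n => inv_pos.2 (hq n), ?_, ?_⟩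
  · apply Tendsto.inv_tendsto_nhdsGT_zero
    exact tendsto_nhdsWithin_iff.2 ⟨hqlim, Eventually.of_forall hq⟩
  · have hb : ∀ n, a n * (Real.sqrt (r n))⁻¹ ≤ 2 * (Real.sqrt (r n) - Real.sqrt (r (n+1))) := by
      intro n
      rw [← div_eq_mul_inv, div_le_iff₀ (hq n)]
      have h1 := Real.mul_self_sqrt (hpos n).le
      have h2 := Real.mul_self_sqrt (hpos (n+1)).le
      have h3 := hstep n
      nlinarith [sq_nonneg (Real.sqrt (r n) - Real.sqrt (r (n+1)))]
    refine summable_of_sum_range_le (c := 2 * Real.sqrt (r 0))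
      (fun n => (mul_pos (ha n) (inv_pos.2 (hq n))).le) ?_
    intro n
    have : ∑ i ∈ Finset.range n, a i * (Real.sqrt (r i))⁻¹
        ≤ 2 * (Real.sqrt (r 0) - Real.sqrt (r n)) := by
      induction n with
      | zero => simp
      | succ k ih => rw [Finset.sum_range_succ]; linarith [hb k]
    linarith [hq n]

/-- Lemma 5.0 / sequence lemma: given `ε, δ > 0` and a summable
sequence of positive reals `(a_j)`, there is a null sequence `(c_j)` of positive reals,
bounded by `1/ε`, with `(a_j/c_j)` summable and
`ε(1-δ/2) Σ a_j ≤ Σ a_j/c_j ≤ ε(1+δ) Σ a_j`. -/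
theorem statement15 (ε δ : ℝ) (hε : 0 < ε) (hδ : 0 < δ)
    (a : ℕ → ℝ) (ha : ∀ j, 0 < a j) (hsum : Summable a) :
    ∃ c : ℕ → ℝ, (∀ j, 0 < c j) ∧ Tendsto c atTop (nhds 0) ∧ (∀ j, c j ≤ 1 / ε) ∧
      Summable (fun j => a j / c j) ∧
      ε * (1 - δ / 2) * ∑' j, a j ≤ ∑' j, a j / c j ∧
      ∑' j, a j / c j ≤ ε * (1 + δ) * ∑' j, a j := by
  obtain ⟨b, hb, hbt, hbs⟩ := aux_weights a ha hsum
  have hS : 0 < ∑' j, a j := hsum.tsum_pos (fun k => (ha _).le) 0 (ha _)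
  have hB : 0 < ∑' j, a j * b j :=
    hbs.tsum_pos (fun k => (mul_pos (ha _) (hb _)).le) 0 (mul_pos (ha _) (hb _))
  obtain ⟨t, ht⟩ : ∃ t, t = δ * (∑' j, a j) / ∑' j, a j * b j := ⟨_, rfl⟩
  have htp : 0 < t := by rw [ht]; positivity
  have hd : ∀ j, 0 < t * b j := fun j => mul_pos htp (hb j)
  have hsm : HasSum (fun j => a j / (ε * (1 + t * b j))⁻¹) (ε * (1 + δ) * ∑' j, a j) := by
    have h := (hsum.hasSum.add (hbs.hasSum.mul_left t)).mul_left ε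
    have e : t * ∑' j, a j * b j = δ * ∑' j, a j := by rw [ht]; field_simp
    rw [e] at h
    have e1 : (fun j => a j / (ε * (1 + t * b j))⁻¹)
        = fun i => ε * (a i + t * (a i * b i)) := by
      funext j
      rw [div_inv_eq_mul]; ring
    have e2 : ε * (1 + δ) * ∑' j, a j = ε * ((∑' j, a j) + δ * ∑' j, a j) := by
      ring
    rw [e1, e2]
    exact h
  refine ⟨fun j => (ε * (1 + t * b j))⁻¹, ?_, ?_, ?_, hsm.summable, ?_, ?_⟩
  · intro j
    have := hd j
    positivity
  · apply Tendsto.inv_tendsto_atTop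
    exact (tendsto_atTop_add_const_left _ 1 (hbt.const_mul_atTop htp)).const_mul_atTop hε
  · intro j
    rw [one_div]
    apply inv_anti₀ hε
    nlinarith [mul_pos hε (hd j)]
  · rw [hsm.tsum_eq]
    have : 0 < ε * δ * ∑' j, a j := by positivity
    nlinarith
  · rw [hsm.tsum_eq]
end
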